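/- The Artstein transform solves a non-delayed equation: let A : ℝ → Matrix (Fin n) (Fin n) ℝ and B : ℝ → Matrix (Fin n) (Fin m) ℝ be measurable and bounded, let h > 0, T > h, let f : ℝ → ℝⁿ be measurable and integrable on [0, T], and let u : ℝ → ℝᵐ be measurable, square integrable on [−h, T], with u(s) = 0 for s ∈ [−h, 0). Suppose x : [0, T] → ℝⁿ is continuous and satisfies x(t) = x(0) + ∫_{0}^{t} (A(s) x(s) + B(s) u(s − h) + f(s)) ds for all t ∈ [0, T]. Define the Artstein transform y(t) := x(t) + ∫_{t−h}^{t} Φ_A(t, s + h) B(s + h) u(s) ds. Then y(0) = x(0) and, for all t ∈ [0, T], y(t) = y(0) + ∫_{0}^{t} (A(s) y(s) + Φ_A(s, s + h) B(s + h) u(s) + f(s)) ds. -/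

import Mathlib

open MeasureTheory

/-- The integral of a vector-valued function is computed componentwise. -/
theorem intervalIntegral_pi_apply {ι : Type*} [Fintype ι] {v : ℝ → ι → ℝ} {a b : ℝ}
    (hv : ∀ i, IntervalIntegrable (fun s => v s i) volume a b) (i : ι) :
    (∫ s in a..b, v s) i = ∫ s in a..b, v s i := by
  simp only [intervalIntegral, Pi.sub_apply]
  rw [eval_integral fun j => (hv j).1, eval_integral fun j => (hv j).2]

theorem intervalIntegrable_finsetSum {ι : Type*} {s : Finset ι} {φ : ι → ℝ → ℝ} {a b : ℝ}
    (hφ : ∀ i ∈ s, IntervalIntegrable (φ i) volume a b) :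
    IntervalIntegrable (fun t => ∑ i ∈ s, φ i t) volume a b :=
  ⟨integrable_finsetSum s fun i hi => (hφ i hi).1, integrable_finsetSum s fun i hi => (hφ i hi).2⟩

theorem intervalIntegrable_of_measurable_of_abs_le {φ : ℝ → ℝ} (hφ : Measurable φ) {C : ℝ}
    (hC : ∀ t, |φ t| ≤ C) (a b : ℝ) : IntervalIntegrable φ volume a b :=
  (intervalIntegrable_const (c := C)).mono_fun hφ.aestronglyMeasurable
    (Filter.Eventually.of_forall fun t => by
      simpa only [Real.norm_eq_abs] using (hC t).trans (le_abs_self C))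

/-- The product rule for primitives of integrable functions. -/
theorem add_integral_mul_integral {α β : ℝ → ℝ} {a b : ℝ} (c : ℝ)
    (hα : IntervalIntegrable α volume a b) (hβ : IntervalIntegrable β volume a b) :
    (c + ∫ s in a..b, α s) * (∫ s in a..b, β s) =
      ∫ s in a..b, (α s * (∫ r in a..s, β r) + (c + ∫ r in a..s, α r) * β s) := by
  have hp := (hα.absolutelyContinuousOnInterval_intervalIntegral (c := a) (by simp)).fun_add
    ((LipschitzWith.const c).lipschitzOnWith.absolutelyContinuousOnInterval (a := a) (b := b))
  have hq := hβ.absolutelyContinuousOnInterval_intervalIntegral (c := a) (by simp)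
  have key := hp.integral_deriv_mul_eq_sub hq
  simp only [intervalIntegral.integral_same, mul_zero, sub_zero] at key
  rw [add_comm c, ← key]
  refine intervalIntegral.integral_congr_ae ?_
  filter_upwards [hα.ae_hasDerivAt_integral, hβ.ae_hasDerivAt_integral] with s hs hs' hmem
  have hmem' := Set.uIoc_subset_uIcc hmem
  rw [((hs hmem' a (by simp)).add_const c).deriv, (hs' hmem' a (by simp)).deriv, add_comm c]

theorem eq_zero_of_le_mul_integral_of_le {w : ℝ → ℝ} (hw : Continuous w) (hw0 : ∀ t, 0 ≤ w t)
    {K s : ℝ} (hK : ∀ t, w t ≤ K * |∫ r in s..t, w r|) {t : ℝ} (hst : s ≤ t) : w t = 0 := by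
  have hderiv (r : ℝ) : HasDerivAt (fun t => ∫ r in s..t, w r) (w r) r :=
    hw.integral_hasStrictDerivAt s r |>.hasDerivAt
  have hzero : ∫ r in s..t, w r = 0 :=
    eq_zero_of_abs_deriv_le_mul_abs_self_of_eq_zero_right (K := K) (a := s) (b := t)
      (fun r _ => (hderiv r).continuousAt.continuousWithinAt)
      (fun r _ => (hderiv r).hasDerivWithinAt) intervalIntegral.integral_same
      (fun r _ => by simpa [Real.norm_eq_abs, abs_of_nonneg (hw0 r)] using hK r)
      t ⟨hst, le_rfl⟩
  have := hK t
  rw [hzero, abs_zero, mul_zero] at this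
  exact le_antisymm this (hw0 t)

/-- A two-sided homogeneous Grönwall inequality in integral form. -/
theorem eq_zero_of_le_mul_integral {w : ℝ → ℝ} (hw : Continuous w) (hw0 : ∀ t, 0 ≤ w t)
    {K s : ℝ} (hK : ∀ t, w t ≤ K * |∫ r in s..t, w r|) (t : ℝ) : w t = 0 := by
  rcases le_total s t with hst | hts
  · exact eq_zero_of_le_mul_integral_of_le hw hw0 hK hst
  · have := eq_zero_of_le_mul_integral_of_le (w := fun r => w (-r)) (K := K) (s := -s) (t := -t)
      (by fun_prop) (fun r => hw0 _) (fun r => ?_) (by linarith)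
    · simpa using this
    · rw [intervalIntegral.integral_comp_neg, neg_neg, intervalIntegral.integral_symm, abs_neg]
      exact hK (-r)

section LinearSystem

variable {n : ℕ} {A : ℝ → Matrix (Fin n) (Fin n) ℝ}

theorem intervalIntegrable_mulVec {ι κ : Type*} [Fintype κ] {D : ℝ → Matrix ι κ ℝ}
    {z : ℝ → κ → ℝ} {a b : ℝ}
    (hD : ∀ i j, IntervalIntegrable (fun t => D t i j) volume a b)
    (hz : ∀ j, ContinuousOn (fun t => z t j) (Set.uIcc a b)) (i : ι) :
    IntervalIntegrable (fun t => (D t).mulVec (z t) i) volume a b := by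
  simp only [Matrix.mulVec, dotProduct]
  exact intervalIntegrable_finsetSum fun j _ => (hD i j).mul_continuousOn (hz j)

/-- Uniqueness of continuous solutions of `z(t) = c + ∫_s^t A(r) z(r) dr` for bounded `A`. -/
theorem eq_of_linear_integral_equation
    (hAint : ∀ i j a b, IntervalIntegrable (fun t => A t i j) volume a b)
    (hAbdd : ∃ C : ℝ, ∀ t i j, |A t i j| ≤ C) {z w : ℝ → Fin n → ℝ}
    (hz : ∀ i, Continuous fun t => z t i) (hw : ∀ i, Continuous fun t => w t i)
    {c : Fin n → ℝ} {s : ℝ}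
    (hzeq : ∀ t i, z t i = c i + ∫ r in s..t, (A r).mulVec (z r) i)
    (hweq : ∀ t i, w t i = c i + ∫ r in s..t, (A r).mulVec (w r) i) (t : ℝ) : z t = w t := by
  obtain ⟨C, hC⟩ := hAbdd
  set δ : ℝ → ℝ := fun t => ∑ i, |z t i - w t i|
  have hδ : Continuous δ := by fun_prop
  have hδ0 (t : ℝ) : 0 ≤ δ t := Finset.sum_nonneg fun i _ => abs_nonneg _
  have hbound (t : ℝ) (i : Fin n) : |z t i - w t i| ≤ C * |∫ r in s..t, δ r| := by
    have hC0 : 0 ≤ C := (abs_nonneg _).trans (hC 0 i i)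
    have hdiff : z t i - w t i = ∫ r in s..t, (A r).mulVec (z r - w r) i := by
      rw [hzeq, hweq, add_sub_add_left_eq_sub, ← intervalIntegral.integral_sub
        (intervalIntegrable_mulVec (fun i j => hAint i j s t) (fun j => (hz j).continuousOn) i)
        (intervalIntegrable_mulVec (fun i j => hAint i j s t) (fun j => (hw j).continuousOn) i)]
      simp only [Matrix.mulVec_sub, Pi.sub_apply]
    have hscale : C * |∫ r in s..t, δ r| = |∫ r in s..t, C * δ r| := by
      rw [intervalIntegral.integral_const_mul, abs_mul, abs_of_nonneg hC0]
    rw [hdiff, ← Real.norm_eq_abs, hscale]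
    refine intervalIntegral.norm_integral_le_abs_of_norm_le
      (Filter.Eventually.of_forall fun r => ?_) ((hδ.const_mul C).intervalIntegrable s t)
    simp only [Matrix.mulVec, dotProduct, Real.norm_eq_abs, Pi.sub_apply, δ, Finset.mul_sum]
    refine (Finset.abs_sum_le_sum_abs _ _).trans (Finset.sum_le_sum fun j _ => ?_)
    rw [abs_mul]
    exact mul_le_mul_of_nonneg_right (hC r i j) (abs_nonneg _)
  have hδz := eq_zero_of_le_mul_integral (K := n * C) (s := s) hδ hδ0 (fun t => by
    refine (Finset.sum_le_sum fun i _ => hbound t i).trans_eq ?_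
    simp [mul_assoc]) t
  ext i
  have := (Finset.sum_eq_zero_iff_of_nonneg fun i _ => abs_nonneg _).1 hδz i (Finset.mem_univ i)
  exact sub_eq_zero.1 (abs_eq_zero.1 this)

variable {Φ : ℝ → ℝ → Matrix (Fin n) (Fin n) ℝ}

/-- The cocycle property of the fundamental matrix. -/
theorem fundamentalMatrix_mul
    (hAint : ∀ i j a b, IntervalIntegrable (fun t => A t i j) volume a b)
    (hAbdd : ∃ C : ℝ, ∀ t i j, |A t i j| ≤ C)
    (hΦcont : ∀ s i j, Continuous fun t => Φ t s i j)
    (hΦeq : ∀ s t i j, Φ t s i j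
        = (1 : Matrix (Fin n) (Fin n) ℝ) i j + ∫ r in s..t, (A r * Φ r s) i j) (t s r : ℝ) :
    Φ t s * Φ s r = Φ t r := by
  have hint (s i j a b) : IntervalIntegrable (fun σ => (A σ * Φ σ s) i j) volume a b :=
    intervalIntegrable_mulVec (z := fun σ k => Φ σ s k j) (fun i j => hAint i j a b)
      (fun k => (hΦcont s k j).continuousOn) i
  ext i j
  refine congrFun (eq_of_linear_integral_equation (A := A)
    (z := fun t i => (Φ t s * Φ s r) i j) (w := fun t i => Φ t r i j)
    (c := fun i => Φ s r i j) (s := s) hAint hAbdd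
    (fun i => ?_) (fun i => hΦcont r i j) (fun t i => ?_) (fun t i => ?_) t) i
  · simp only [Matrix.mul_apply]
    exact continuous_finsetSum _ fun k _ => (hΦcont s i k).mul continuous_const
  · have hmul (σ : ℝ) : (A σ).mulVec (fun i => (Φ σ s * Φ s r) i j) i
        = ∑ k, (A σ * Φ σ s) i k * Φ s r k j := by
      change (A σ * (Φ σ s * Φ s r)) i j = _
      rw [← Matrix.mul_assoc, Matrix.mul_apply]
    simp only [hmul]
    rw [intervalIntegral.integral_finsetSum fun k _ => (hint s i k s t).mul_const _]
    simp only [intervalIntegral.integral_mul_const]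
    nth_rewrite 2 [← Matrix.one_mul (Φ s r)]
    simp only [Matrix.mul_apply (M := Φ t s), Matrix.mul_apply (M := (1 : Matrix _ _ ℝ)),
      ← Finset.sum_add_distrib, ← add_mul, hΦeq s t]
  · change Φ t r i j = Φ s r i j + ∫ σ in s..t, (A σ * Φ σ r) i j
    rw [hΦeq r t, hΦeq r s, add_assoc, intervalIntegral.integral_add_adjacent_intervals
      (hint r i j r s) (hint r i j s t)]

theorem fundamentalMatrix_self
    (hΦeq : ∀ s t i j, Φ t s i j
        = (1 : Matrix (Fin n) (Fin n) ℝ) i j + ∫ r in s..t, (A r * Φ r s) i j) (s : ℝ) :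
    Φ s s = 1 := by
  ext i j
  simp [hΦeq s s]

/-- The fundamental matrix is continuous in its second variable. -/
theorem continuous_fundamentalMatrix_right
    (hAint : ∀ i j a b, IntervalIntegrable (fun t => A t i j) volume a b)
    (hAbdd : ∃ C : ℝ, ∀ t i j, |A t i j| ≤ C)
    (hΦcont : ∀ s i j, Continuous fun t => Φ t s i j)
    (hΦeq : ∀ s t i j, Φ t s i j
        = (1 : Matrix (Fin n) (Fin n) ℝ) i j + ∫ r in s..t, (A r * Φ r s) i j)
    (t : ℝ) (i j : Fin n) : Continuous fun s => Φ t s i j := by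
  have hleft (s : ℝ) : Φ t s * Φ s t = 1 := by
    rw [fundamentalMatrix_mul hAint hAbdd hΦcont hΦeq, fundamentalMatrix_self hΦeq]
  have hcont : Continuous fun s => Φ s t :=
    continuous_matrix fun i j => hΦcont t i j
  have hdet (s : ℝ) : (Φ s t).det ≠ 0 := fun h0 => by
    simpa [h0] using congrArg Matrix.det (hleft s)
  have hinv : (fun s => Φ t s) = fun s => ((Φ s t).det)⁻¹ • (Φ s t).adjugate := by
    ext1 s
    rw [← Matrix.inv_eq_left_inv (hleft s), Matrix.inv_def, Ring.inverse_eq_inv']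
  have : Continuous fun s => Φ t s := by
    rw [hinv]
    exact (hcont.matrix_det.inv₀ hdet).smul hcont.matrix_adjugate
  exact this.matrix_elem i j

end LinearSystem

theorem integrableOn_of_integrableOn_sum_sq {ι : Type*} [Fintype ι] {u : ℝ → ι → ℝ}
    {S : Set ℝ} (hS : volume S ≠ ⊤) (humeas : ∀ i, Measurable fun t => u t i)
    (husq : IntegrableOn (fun t => ∑ i, (u t i) ^ 2) S) (i : ι) :
    IntegrableOn (fun t => u t i) S := by
  refine ((integrableOn_const hS (C := (1 : ℝ))).add husq).mono'
    (humeas i).aestronglyMeasurable (Filter.Eventually.of_forall fun t => ?_)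
  have h1 : (u t i) ^ 2 ≤ ∑ i, (u t i) ^ 2 :=
    Finset.single_le_sum (f := fun i => (u t i) ^ 2) (fun j _ => sq_nonneg _) (Finset.mem_univ i)
  simp only [Pi.add_apply, Real.norm_eq_abs]
  nlinarith [sq_abs (u t i), sq_nonneg (|u t i| - 1)]

/-- A moving-window integral of a function vanishing on the initial window. -/
theorem integral_window_eq {g : ℝ → ℝ} {h T t : ℝ} (hh : 0 < h)
    (hg : IntervalIntegrable g volume (-h) T) (hg0 : ∀ s ∈ Set.Ico (-h) (0 : ℝ), g s = 0)
    (ht : t ∈ Set.Icc 0 T) :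
    IntervalIntegrable (fun s => g (s - h)) volume 0 t ∧
      ∫ s in (t - h)..t, g s = ∫ s in (0 : ℝ)..t, (g s - g (s - h)) := by
  obtain ⟨ht0, htT⟩ := ht
  have hsub {a b : ℝ} (ha : -h ≤ a) (haT : a ≤ T) (hb : -h ≤ b) (hbT : b ≤ T) :
      IntervalIntegrable g volume a b :=
    hg.mono_set (Set.uIcc_subset_uIcc (Set.mem_uIcc_of_le ha haT) (Set.mem_uIcc_of_le hb hbT))
  have hshift : IntervalIntegrable (fun s => g (s - h)) volume 0 t := by
    have := (hsub (a := -h) (b := t - h) le_rfl (by linarith) (by linarith)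
      (by linarith)).comp_sub_right h
    simpa using this
  refine ⟨hshift, ?_⟩
  have hzero : ∫ s in (-h)..0, g s = 0 := by
    rw [intervalIntegral.integral_of_le (by linarith), integral_Ioc_eq_integral_Ioo]
    exact setIntegral_eq_zero_of_forall_eq_zero fun s hs => hg0 s ⟨hs.1.le, hs.2⟩
  rw [intervalIntegral.integral_sub (hsub (by linarith) (by linarith) (by linarith) htT) hshift,
    intervalIntegral.integral_comp_sub_right, zero_sub,
    ← intervalIntegral.integral_interval_sub_left (a := -h)
      (hsub le_rfl (by linarith) (by linarith) htT)
      (hsub le_rfl (by linarith) (by linarith) (by linarith)),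
    ← intervalIntegral.integral_add_adjacent_intervals (b := 0)
      (hsub le_rfl (by linarith) (by linarith) (by linarith))
      (hsub (by linarith) (by linarith) (by linarith) htT), hzero, zero_add]

/-- The Artstein transform `y(t) = x(t) + ∫_{t-h}^{t} Φ_A(t, s+h) B(s+h) u(s) ds` of a
solution `x` of the input-delayed equation
`x(t) = x(0) + ∫_0^t (A(s) x(s) + B(s) u(s-h) + f(s)) ds`
satisfies `y(0) = x(0)` and solves the non-delayed equation
`y(t) = y(0) + ∫_0^t (A(s) y(s) + Φ_A(s, s+h) B(s+h) u(s) + f(s)) ds`. -/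
theorem artstein_transform_solves_nondelayed
    (n m : ℕ)
    (A : ℝ → Matrix (Fin n) (Fin n) ℝ)
    (hAmeas : ∀ i j, Measurable fun t => A t i j)
    (hAbdd : ∃ C : ℝ, ∀ t i j, |A t i j| ≤ C)
    (Φ : ℝ → ℝ → Matrix (Fin n) (Fin n) ℝ)
    (hΦcont : ∀ s i j, Continuous fun t => Φ t s i j)
    (hΦeq : ∀ s t i j, Φ t s i j
        = (1 : Matrix (Fin n) (Fin n) ℝ) i j + ∫ r in s..t, (A r * Φ r s) i j)
    (B : ℝ → Matrix (Fin n) (Fin m) ℝ)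
    (hBmeas : ∀ i j, Measurable fun t => B t i j)
    (hBbdd : ∃ C : ℝ, ∀ t i j, |B t i j| ≤ C)
    (h T : ℝ) (hh : 0 < h) (hT : h < T)
    (f : ℝ → Fin n → ℝ)
    (hfmeas : ∀ i, Measurable fun t => f t i)
    (hfint : ∀ i, IntervalIntegrable (fun t => f t i) volume 0 T)
    (u : ℝ → Fin m → ℝ)
    (humeas : ∀ i, Measurable fun t => u t i)
    (husq : IntegrableOn (fun t => ∑ i, (u t i) ^ 2) (Set.Icc (-h) T))
    (huzero : ∀ s ∈ Set.Ico (-h) (0 : ℝ), u s = 0)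
    (x : ℝ → Fin n → ℝ)
    (hxcont : ∀ i, ContinuousOn (fun t => x t i) (Set.Icc 0 T))
    (hx : ∀ t ∈ Set.Icc (0 : ℝ) T,
      x t = x 0 + ∫ s in (0 : ℝ)..t, ((A s).mulVec (x s) + (B s).mulVec (u (s - h)) + f s))
    (y : ℝ → Fin n → ℝ)
    (hy : ∀ t, y t = x t + ∫ s in (t - h)..t, (Φ t (s + h)).mulVec ((B (s + h)).mulVec (u s))) :
    y 0 = x 0 ∧
      ∀ t ∈ Set.Icc (0 : ℝ) T,
        y t = y 0 + ∫ s in (0 : ℝ)..t,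
          ((A s).mulVec (y s) + (Φ s (s + h) * B (s + h)).mulVec (u s) + f s) := by
  have hAint (i j a b) : IntervalIntegrable (fun t => A t i j) volume a b :=
    let ⟨_, hC⟩ := hAbdd
    intervalIntegrable_of_measurable_of_abs_le (hAmeas i j) (fun t => hC t i j) a b
  have hT0 : 0 ≤ T := by linarith
  have hmul := fundamentalMatrix_mul hAint hAbdd hΦcont hΦeq
  have hΦright := continuous_fundamentalMatrix_right hAint hAbdd hΦcont hΦeq 0
  have huint (l : Fin m) : IntervalIntegrable (fun t => u t l) volume (-h) T :=
    (intervalIntegrable_iff_integrableOn_Icc_of_le (by linarith)).2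
      (integrableOn_of_integrableOn_sum_sq (by simp) humeas husq l)
  have hBu {v : ℝ → Fin m → ℝ} {a b τ : ℝ}
      (hv : ∀ l, IntervalIntegrable (fun t => v t l) volume a b) (k : Fin n) :
      IntervalIntegrable (fun s => (B (s + τ)).mulVec (v s) k) volume a b := by
    obtain ⟨C, hC⟩ := hBbdd
    simp only [Matrix.mulVec, dotProduct]
    refine intervalIntegrable_finsetSum fun l _ => ?_
    have hmeas : Measurable fun s => B (s + τ) k l :=
      (hBmeas k l).comp (measurable_id.add_const τ)
    exact ⟨(hv l).1.bdd_mul (c := C) hmeas.aestronglyMeasurable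
        (Filter.Eventually.of_forall fun s => hC _ k l),
      (hv l).2.bdd_mul (c := C) hmeas.aestronglyMeasurable
        (Filter.Eventually.of_forall fun s => hC _ k l)⟩
  set g : ℝ → Fin n → ℝ := fun s => (Φ 0 (s + h)).mulVec ((B (s + h)).mulVec (u s)) with hg
  have hgint (k : Fin n) : IntervalIntegrable (fun s => g s k) volume (-h) T := by
    change IntervalIntegrable
      (fun s => ∑ l, Φ 0 (s + h) k l * (B (s + h)).mulVec (u s) l) volume (-h) T
    exact intervalIntegrable_finsetSum fun l _ => (hBu huint l).continuousOn_mul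
      (((hΦright k l).comp (continuous_add_const h)).continuousOn)
  have hg0 (k : Fin n) : ∀ s ∈ Set.Ico (-h) (0 : ℝ), g s k = 0 := fun s hs => by
    simp [hg, huzero s hs]
  have hgsub {a b : ℝ} (ha : -h ≤ a) (haT : a ≤ T) (hb : -h ≤ b) (hbT : b ≤ T) (k : Fin n) :
      IntervalIntegrable (fun s => g s k) volume a b :=
    (hgint k).mono_set
      (Set.uIcc_subset_uIcc (Set.mem_uIcc_of_le ha haT) (Set.mem_uIcc_of_le hb hbT))
  set q : ℝ → Fin n → ℝ := fun t k => ∫ s in (0 : ℝ)..t, (g s k - g (s - h) k) with hq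
  have hyq : ∀ t ∈ Set.Icc (0 : ℝ) T, y t = x t + (Φ t 0).mulVec (q t) := by
    intro t ht
    rw [hy]
    congr 1
    ext i
    have hgt := hgsub (a := t - h) (b := t) (by linarith [ht.1]) (by linarith [ht.2])
      (by linarith [ht.1]) ht.2
    have hfac (s : ℝ) : (Φ t (s + h)).mulVec ((B (s + h)).mulVec (u s))
        = (Φ t 0).mulVec (g s) := by
      simp only [hg]
      rw [Matrix.mulVec_mulVec (M := Φ t 0), hmul]
    simp only [hfac]
    have hsum (i : Fin n) (k : Fin n) :
        IntervalIntegrable (fun s => Φ t 0 i k * g s k) volume (t - h) t := (hgt k).const_mul _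
    rw [intervalIntegral_pi_apply (fun i => by
      simp only [Matrix.mulVec, dotProduct]
      exact intervalIntegrable_finsetSum fun k _ => hsum i k)]
    simp only [Matrix.mulVec, dotProduct]
    rw [intervalIntegral.integral_finsetSum fun k _ => hsum i k]
    refine Finset.sum_congr rfl fun k _ => ?_
    rw [intervalIntegral.integral_const_mul,
      (integral_window_eq (g := fun s => g s k) hh (hgint k) (hg0 k) ht).2]
  have hy0 : y 0 = x 0 := by
    rw [hyq 0 ⟨le_rfl, hT0⟩]
    have : q 0 = 0 := by ext k; simp [hq]
    rw [this, Matrix.mulVec_zero, add_zero]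
  refine ⟨hy0, fun t ht => ?_⟩
  have hsubset : Set.uIcc 0 t ⊆ Set.Icc 0 T := by
    rw [Set.uIcc_of_le ht.1]
    exact Set.Icc_subset_Icc_right ht.2
  have hAΦ (i k) : IntervalIntegrable (fun s => (A s * Φ s 0) i k) volume 0 t :=
    intervalIntegrable_mulVec (z := fun s j => Φ s 0 j k) (fun i j => hAint i j 0 t)
      (fun j => (hΦcont 0 j k).continuousOn) i
  have hdg (k : Fin n) : IntervalIntegrable (fun s => g s k - g (s - h) k) volume 0 t :=
    (hgsub (by linarith) hT0 (by linarith [ht.1]) ht.2 k).sub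
      (integral_window_eq (g := fun s => g s k) hh (hgint k) (hg0 k) ht).1
  have hqcont (k : Fin n) : ContinuousOn (fun s => q s k) (Set.uIcc 0 t) :=
    intervalIntegral.continuousOn_primitive_interval' (hdg k) (by simp)
  have hxint (i : Fin n) : IntervalIntegrable
      (fun s => ((A s).mulVec (x s) + (B s).mulVec (u (s - h)) + f s) i) volume 0 t := by
    refine ((intervalIntegrable_mulVec (fun i j => hAint i j 0 t)
      (fun j => (hxcont j).mono hsubset) i).add ?_).add
      ((hfint i).mono_set (by rwa [Set.uIcc_of_le hT0]))
    have hush (l : Fin m) : IntervalIntegrable (fun s => u (s - h) l) volume 0 t :=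
      (integral_window_eq (g := fun s => u s l) hh (huint l)
        (fun s hs => by simp [huzero s hs]) ht).1
    simpa using hBu (τ := 0) hush i
  have hterm (i k : Fin n) : IntervalIntegrable (fun s =>
      (A s * Φ s 0) i k * q s k + Φ s 0 i k * (g s k - g (s - h) k)) volume 0 t :=
    ((hAΦ i k).mul_continuousOn (hqcont k)).add
      ((hdg k).continuousOn_mul (hΦcont 0 i k).continuousOn)
  have hprod (i k : Fin n) : Φ t 0 i k * q t k = ∫ s in (0 : ℝ)..t,
      ((A s * Φ s 0) i k * q s k + Φ s 0 i k * (g s k - g (s - h) k)) := by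
    simpa only [← hΦeq] using
      add_integral_mul_integral ((1 : Matrix (Fin n) (Fin n) ℝ) i k) (hAΦ i k) (hdg k)
  have hpt : ∀ s ∈ Set.uIcc 0 t, ∀ i,
      ((A s).mulVec (x s) + (B s).mulVec (u (s - h)) + f s) i
        + ∑ k, ((A s * Φ s 0) i k * q s k + Φ s 0 i k * (g s k - g (s - h) k))
      = ((A s).mulVec (y s) + (Φ s (s + h) * B (s + h)).mulVec (u s) + f s) i := by
    intro s hs i
    have hshift : (Φ s 0).mulVec (g (s - h)) = (B s).mulVec (u (s - h)) := by
      simp only [hg, sub_add_cancel]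
      rw [Matrix.mulVec_mulVec (M := Φ s 0), hmul, fundamentalMatrix_self hΦeq, Matrix.one_mulVec]
    have hnow : (Φ s 0).mulVec (g s) = (Φ s (s + h) * B (s + h)).mulVec (u s) := by
      simp only [hg]
      rw [Matrix.mulVec_mulVec (M := Φ s 0), hmul, Matrix.mulVec_mulVec]
    have hsum : ∑ k, ((A s * Φ s 0) i k * q s k + Φ s 0 i k * (g s k - g (s - h) k))
        = ((A s * Φ s 0).mulVec (q s) + (Φ s 0).mulVec (g s - g (s - h))) i := by
      simp only [Finset.sum_add_distrib, Pi.add_apply, Matrix.mulVec, dotProduct, Pi.sub_apply]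
    rw [hsum, hyq s (hsubset hs), Matrix.mulVec_sub, hshift, hnow, Matrix.mulVec_add,
      Matrix.mulVec_mulVec]
    simp only [Pi.add_apply, Pi.sub_apply]
    ring
  have hsumint (i : Fin n) : IntervalIntegrable (fun s => ∑ k,
      ((A s * Φ s 0) i k * q s k + Φ s 0 i k * (g s k - g (s - h) k))) volume 0 t :=
    intervalIntegrable_finsetSum fun k _ => hterm i k
  ext i
  have hyint (i : Fin n) : IntervalIntegrable (fun s =>
      ((A s).mulVec (y s) + (Φ s (s + h) * B (s + h)).mulVec (u s) + f s) i) volume 0 t :=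
    ((hxint i).add (hsumint i)).congr fun s hs => hpt s (Set.uIoc_subset_uIcc hs) i
  rw [Pi.add_apply, intervalIntegral_pi_apply hyint,
    ← intervalIntegral.integral_congr fun s hs => hpt s hs i,
    intervalIntegral.integral_add (hxint i) (hsumint i),
    intervalIntegral.integral_finsetSum fun k _ => hterm i k, hyq t ht, hx t ht, hy0]
  simp only [Pi.add_apply, intervalIntegral_pi_apply hxint, ← hprod]
  simp only [Matrix.mulVec, dotProduct, add_assoc]
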